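/- In a unit-capacity network (u ≡ 1), if there exists a reroutable s-t-flow of value 1, then there exists a half-integral strictly reroutable s-t-flow of value 1 whose support consists of at most two s-t-paths (i.e., either one path carrying flow 1, or two paths each carrying flow 1/2). -/

import Mathlib

open scoped BigOperators

variable {V A : Type}

/-- `IsWalk tl hd v w L`: the list of arcs `L` forms a walk from `v` to `w`
in the digraph whose arcs `a` go from `tl a` to `hd a`. -/
def IsWalk (tl hd : A → V) : V → V → List A → Prop
  | v, w, [] => v = w
  | v, w, a :: L => tl a = v ∧ IsWalk tl hd (hd a) w L

/-- A simple path from `v` to `w`: a walk visiting no vertex twice. -/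
def IsPath (tl hd : A → V) (v w : V) (L : List A) : Prop :=
  IsWalk tl hd v w L ∧ (v :: L.map hd).Nodup

/-- `Before L b a`: the list `L` traverses `b` (strictly) before `a`. -/
def Before (L : List A) (b a : A) : Prop :=
  ∃ l₁ l₂ l₃ : List A, L = l₁ ++ b :: (l₂ ++ a :: l₃)

/-- Sum of a path-flow over a set of paths. -/
noncomputable def sumOver (x : List A → ℝ) (S : Set (List A)) : ℝ :=
  ∑ᶠ P ∈ S, x P

/-- Flow value `x(a)` on an arc `a`: total flow on `s`-`t`-paths through `a`. -/
noncomputable def arcFlow (tl hd : A → V) (s t : V) (x : List A → ℝ) (a : A) : ℝ :=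
  sumOver x {P | IsPath tl hd s t P ∧ a ∈ P}

/-- The value of a flow: total flow on all `s`-`t`-paths. -/
noncomputable def flowVal (tl hd : A → V) (s t : V) (x : List A → ℝ) : ℝ :=
  sumOver x {P | IsPath tl hd s t P}

/-- An `s`-`t`-(path-)flow: nonnegative, supported on simple `s`-`t`-paths,
respecting the arc capacities `u`. -/
def IsFlow (tl hd : A → V) (s t : V) (u : A → ℝ) (x : List A → ℝ) : Prop :=
  (∀ P, 0 ≤ x P) ∧ (∀ P, ¬ IsPath tl hd s t P → x P = 0) ∧
    ∀ a : A, arcFlow tl hd s t x a ≤ u a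

/-- Available capacity `ū_{x,b}(a)` of arc `a` after failure of arc `b`:
`u(a)` minus the flow on paths through `a` that do not traverse `b` before `a`. -/
noncomputable def availCap (tl hd : A → V) (s t : V) (u : A → ℝ) (x : List A → ℝ)
    (b a : A) : ℝ :=
  u a - sumOver x {P | IsPath tl hd s t P ∧ a ∈ P ∧ ¬ Before P b a}

/-- Arc flow of a rerouting flow `y` for failing arc `b`: `y` lives on
`tl b`-`t`-paths avoiding `b`. -/
noncomputable def reArcFlow (tl hd : A → V) (t : V) (b : A) (y : List A → ℝ) (a : A) : ℝ :=
  sumOver y {Q | IsPath tl hd (tl b) t Q ∧ b ∉ Q ∧ a ∈ Q}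

/-- Value of a rerouting flow `y` for failing arc `b`. -/
noncomputable def reVal (tl hd : A → V) (t : V) (b : A) (y : List A → ℝ) : ℝ :=
  sumOver y {Q | IsPath tl hd (tl b) t Q ∧ b ∉ Q}

/-- `y` is a rerouting of `x` for the failing arc `b`: a `tl b`-`t`-flow of value
`x(b)` in `(V, A ∖ {b})` with capacities `ū_{x,b}`. -/
def IsRerouting (tl hd : A → V) (s t : V) (u : A → ℝ) (x : List A → ℝ) (b : A)
    (y : List A → ℝ) : Prop :=
  (∀ Q, 0 ≤ y Q) ∧
  (∀ Q, ¬ (IsPath tl hd (tl b) t Q ∧ b ∉ Q) → y Q = 0) ∧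
  (∀ a : A, a ≠ b → reArcFlow tl hd t b y a ≤ availCap tl hd s t u x b a) ∧
  reVal tl hd t b y = arcFlow tl hd s t x b

/-- `y` is a strict rerouting of `x` for the failing arc `b`: a `tl b`-`t`-flow
of value `x(b)` in `(V, A ∖ {b})` with `y(a) ≤ u(a) - x(a)` for all `a ≠ b`. -/
def IsStrictRerouting (tl hd : A → V) (s t : V) (u : A → ℝ) (x : List A → ℝ) (b : A)
    (y : List A → ℝ) : Prop :=
  (∀ Q, 0 ≤ y Q) ∧
  (∀ Q, ¬ (IsPath tl hd (tl b) t Q ∧ b ∉ Q) → y Q = 0) ∧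
  (∀ a : A, a ≠ b → reArcFlow tl hd t b y a ≤ u a - arcFlow tl hd s t x a) ∧
  reVal tl hd t b y = arcFlow tl hd s t x b

/-- `x` is reroutable: a rerouting exists for every failing arc. -/
def Reroutable (tl hd : A → V) (s t : V) (u : A → ℝ) (x : List A → ℝ) : Prop :=
  ∀ b : A, ∃ y : List A → ℝ, IsRerouting tl hd s t u x b y

/-- `x` is strictly reroutable: a strict rerouting exists for every failing arc. -/
def StrictlyReroutable (tl hd : A → V) (s t : V) (u : A → ℝ) (x : List A → ℝ) : Prop :=
  ∀ b : A, ∃ y : List A → ℝ, IsStrictRerouting tl hd s t u x b y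

theorem walk_append (tl hd : A → V) (l₁ l₂ : List A) : ∀ v w : V,
    IsWalk tl hd v w (l₁ ++ l₂) ↔ ∃ u, IsWalk tl hd v u l₁ ∧ IsWalk tl hd u w l₂ := by
  induction l₁ with
  | nil => intro v w; simp [IsWalk]
  | cons a l ih => intro v w; simp [IsWalk, ih, and_assoc]

theorem path_suffix (tl hd : A → V) (w v : V) (L : List A) : ∀ u : V,
    IsPath tl hd u w L → v ∈ u :: L.map hd → ∃ L', IsPath tl hd v w L' ∧ L' ⊆ L := by
  induction L with
  | nil =>
    intro u h hv
    simp at hv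
    subst hv
    exact ⟨[], h, by simp⟩
  | cons a l ih =>
    intro u h hv
    rw [List.mem_cons] at hv
    rcases hv with rfl | hv
    · exact ⟨_, h, fun _ h => h⟩
    · obtain ⟨⟨h1, h2⟩, h3⟩ := h
      rw [List.map_cons, List.nodup_cons] at h3
      obtain ⟨L', h4, h5⟩ := ih (hd a) ⟨h2, h3.2⟩ (by simpa using hv)
      exact ⟨L', h4, fun _ h => List.mem_cons_of_mem _ (h5 h)⟩

theorem walk_to_path (tl hd : A → V) (w : V) (L : List A) : ∀ v : V,
    IsWalk tl hd v w L → ∃ L', IsPath tl hd v w L' ∧ L' ⊆ L := by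
  induction L with
  | nil => intro v h; exact ⟨[], ⟨h, by simp⟩, by simp⟩
  | cons a l ih =>
    intro v h
    obtain ⟨h1, h2⟩ := h
    obtain ⟨L', h3, h4⟩ := ih _ h2
    by_cases hv : v ∈ hd a :: L'.map hd
    · obtain ⟨L'', h5, h6⟩ := path_suffix tl hd w v L' _ h3 hv
      exact ⟨L'', h5, fun _ h => List.mem_cons_of_mem _ (h4 (h6 h))⟩
    · refine ⟨a :: L', ⟨⟨h1, h3.1⟩, ?_⟩, ?_⟩
      · rw [List.map_cons, List.nodup_cons]
        exact ⟨hv, h3.2⟩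
      · intro e he
        rw [List.mem_cons] at he ⊢
        exact he.imp id (fun h => h4 h)

theorem walk_cross (tl hd : A → V) (S : Set V) (w : V) (hw : w ∉ S) (L : List A) : ∀ v : V,
    IsWalk tl hd v w L → v ∈ S → ∃ a ∈ L, tl a ∈ S ∧ hd a ∉ S := by
  induction L with
  | nil => intro v h hv; cases h; exact absurd hv hw
  | cons a l ih =>
    intro v h hv
    obtain ⟨h1, h2⟩ := h
    by_cases ha : hd a ∈ S
    · obtain ⟨e, he, h⟩ := ih _ h2 ha
      exact ⟨e, List.mem_cons_of_mem _ he, h⟩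
    · exact ⟨a, by simp, by rw [h1]; exact hv, ha⟩

theorem reach (tl hd : A → V) (p : A → Prop) (v w : V) :
    (∃ L, IsPath tl hd v w L ∧ ∀ a ∈ L, p a) ∨
    ∃ S : Set V, v ∈ S ∧ w ∉ S ∧ ∀ a, p a → tl a ∈ S → hd a ∈ S := by
  by_cases h : ∃ L, IsWalk tl hd v w L ∧ ∀ a ∈ L, p a
  · left
    obtain ⟨L, h1, h2⟩ := h
    obtain ⟨L', h3, h4⟩ := walk_to_path tl hd w L v h1
    exact ⟨L', h3, fun a ha => h2 a (h4 ha)⟩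
  · right
    refine ⟨{u | ∃ L, IsWalk tl hd v u L ∧ ∀ a ∈ L, p a}, ⟨[], rfl, by simp⟩, h, ?_⟩
    rintro a ha ⟨L, h1, h2⟩
    refine ⟨L ++ [a], (walk_append tl hd _ _ _ _).2 ⟨_, h1, rfl, rfl⟩, ?_⟩
    intro e he
    rw [List.mem_append, List.mem_singleton] at he
    rcases he with he | rfl
    · exact h2 e he
    · exact ha

open Classical in
noncomputable def ind (S : Set V) (v : V) : ℤ := if v ∈ S then 1 else 0

/-- `f` is an arc flow from `v` to `t` of value `k`. -/
def IsVal [Fintype A] (tl hd : A → V) (v t : V) (f : A → ℤ) (k : ℤ) : Prop :=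
  ∀ S : Set V, ∑ a, f a * (ind S (tl a) - ind S (hd a)) = k * (ind S v - ind S t)

theorem walk_sum (tl hd : A → V) (S : Set V) (w : V) (L : List A) : ∀ v : V,
    IsWalk tl hd v w L → (L.map (fun a => ind S (tl a) - ind S (hd a))).sum = ind S v - ind S w := by
  induction L with
  | nil => intro v h; cases h; simp
  | cons a l ih =>
    intro v h
    obtain ⟨h1, h2⟩ := h
    rw [List.map_cons, List.sum_cons, ih _ h2, h1]; ring

theorem sum_count [Fintype A] [DecidableEq A] (g : A → ℤ) (L : List A) :
    ∑ a, (L.count a : ℤ) * g a = (L.map g).sum := by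
  induction L with
  | nil => simp
  | cons b l ih =>
    simp only [List.count_cons, List.map_cons, List.sum_cons, ← ih]
    push_cast
    simp [add_mul, Finset.sum_add_distrib, add_comm]

theorem path_nodup (tl hd : A → V) (v w : V) (L : List A) (h : IsPath tl hd v w L) : L.Nodup :=
  (List.nodup_cons.1 h.2).2.of_map

theorem exists_cnt [Fintype A] [DecidableEq A] (L : List A) (hn : L.Nodup) :
    ∃ cnt : A → ℤ, (∀ a, 0 ≤ cnt a) ∧ (∀ a, cnt a ≤ 1) ∧ (∀ a, a ∉ L → cnt a = 0) ∧
      ∀ g : A → ℤ, ∑ a, cnt a * g a = (L.map g).sum := by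
  refine ⟨fun a => L.count a, fun a => by positivity, fun a => ?_, fun a ha => ?_,
    fun g => sum_count g L⟩
  · show ((L.count a : ℕ) : ℤ) ≤ 1
    exact_mod_cast List.nodup_iff_count_le_one.1 hn a
  · show ((L.count a : ℕ) : ℤ) = 0
    exact_mod_cast List.count_eq_zero.2 ha

theorem step [Fintype A] [DecidableEq A] (tl hd : A → V) (v t : V) (c f : A → ℤ) (k : ℤ)
    (h0 : ∀ a, 0 ≤ f a) (h1 : ∀ a, f a ≤ c a) (hf : IsVal tl hd v t f k) :
    (∃ f' : A → ℤ, (∀ a, 0 ≤ f' a) ∧ (∀ a, f' a ≤ c a) ∧ IsVal tl hd v t f' (k + 1)) ∨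
    ∃ S : Set V, v ∈ S ∧ t ∉ S ∧
      ∀ T : Finset A, (∀ a, a ∈ T ↔ tl a ∈ S ∧ hd a ∉ S) → ∑ a ∈ T, c a = k := by
  rcases reach (Sum.elim tl hd) (Sum.elim hd tl)
    (Sum.elim (fun a => f a < c a) (fun a => 0 < f a)) v t with ⟨L, hL, hp⟩ | ⟨S, hv, ht, hS⟩
  · left
    have hn := path_nodup _ _ _ _ _ hL
    obtain ⟨cnt, n0, n1, n2, n3⟩ := exists_cnt L hn
    refine ⟨fun a => f a + cnt (Sum.inl a) - cnt (Sum.inr a), ?_, ?_, ?_⟩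
    · intro a
      show 0 ≤ f a + cnt (Sum.inl a) - cnt (Sum.inr a)
      have := h0 a
      have := n0 (Sum.inl a)
      have := n1 (Sum.inr a)
      by_cases h : Sum.inr a ∈ L
      · have : 0 < f a := hp _ h
        omega
      · have := n2 _ h
        omega
    · intro a
      show f a + cnt (Sum.inl a) - cnt (Sum.inr a) ≤ c a
      have := h1 a
      have := n0 (Sum.inr a)
      have := n1 (Sum.inl a)
      by_cases h : Sum.inl a ∈ L
      · have : f a < c a := hp _ h
        omega
      · have := n2 _ h
        omega
    · intro S
      have e1 := walk_sum _ _ S _ _ _ hL.1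
      rw [← n3, Fintype.sum_sum_type] at e1
      simp only [Sum.elim_inl, Sum.elim_inr] at e1
      rw [add_mul, one_mul, ← hf S, ← e1, ← Finset.sum_add_distrib, ← Finset.sum_add_distrib]
      exact Finset.sum_congr rfl fun a _ => by ring
  · right
    refine ⟨S, hv, ht, fun T hT => ?_⟩
    have := hf S
    rw [show ind S v = 1 by simp [ind, hv], show ind S t = 0 by simp [ind, ht]] at this
    rw [sub_zero, mul_one] at this
    rw [← this, ← Finset.sum_subset (Finset.subset_univ T)]
    · refine Finset.sum_congr rfl fun a ha => ?_
      obtain ⟨h2, h3⟩ := (hT a).1 ha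
      have : ¬ f a < c a := fun h => h3 (hS (Sum.inl a) h h2)
      have := h1 a
      simp [ind, h2, h3]; omega
    · intro a _ ha
      rw [hT] at ha
      by_cases h2 : tl a ∈ S <;> by_cases h3 : hd a ∈ S
      · simp [ind, h2, h3]
      · exact absurd ⟨h2, h3⟩ ha
      · have : ¬ 0 < f a := fun h => h2 (hS (Sum.inr a) h h3)
        have := h0 a
        have : f a = 0 := by omega
        simp [this]
      · simp [ind, h2, h3]

theorem decomp [Fintype A] [DecidableEq A] (tl hd : A → V) (v t : V) (f : A → ℤ) (k : ℤ)
    (hk : 0 < k) (h0 : ∀ a, 0 ≤ f a) (hf : IsVal tl hd v t f k) :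
    ∃ L, IsPath tl hd v t L ∧ (∀ a, (L.count a : ℤ) ≤ f a) ∧
      IsVal tl hd v t (fun a => f a - L.count a) (k - 1) := by
  rcases reach tl hd (fun a => 0 < f a) v t with ⟨L, hL, hp⟩ | ⟨S, hv, ht, hS⟩
  · have hn := path_nodup _ _ _ _ _ hL
    refine ⟨L, hL, ?_, ?_⟩
    · intro a
      have := h0 a
      have h2 := List.nodup_iff_count_le_one.1 hn a
      by_cases h : a ∈ L
      · have := hp _ h
        omega
      · have := List.count_eq_zero.2 h
        omega
    · intro S
      have e1 := walk_sum _ _ S _ _ _ hL.1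
      rw [← sum_count] at e1
      rw [sub_mul, one_mul, ← hf S, ← e1, ← Finset.sum_sub_distrib]
      exact Finset.sum_congr rfl fun a _ => by ring
  · exfalso
    have := hf S
    rw [show ind S v = 1 by simp [ind, hv], show ind S t = 0 by simp [ind, ht]] at this
    have h2 : ∑ a, f a * (ind S (tl a) - ind S (hd a)) ≤ 0 := by
      apply Finset.sum_nonpos
      intro a _
      rcases (h0 a).eq_or_lt with h | h
      · simp [← h]
      · have := hS a h
        by_cases h2 : tl a ∈ S
        · simp [ind, h2, this h2]
        · have : ind S (tl a) = 0 := by simp [ind, h2]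
          have h4 : 0 ≤ ind S (hd a) := by unfold ind; split_ifs <;> simp
          rw [this]; nlinarith
    omega

theorem two_paths [Fintype A] [DecidableEq A] (tl hd : A → V) (v t : V) (c : A → ℤ)
    (hc : ∀ a, 0 ≤ c a) :
    (∃ Q₁ Q₂, IsPath tl hd v t Q₁ ∧ IsPath tl hd v t Q₂ ∧
      ∀ a, (Q₁.count a : ℤ) + Q₂.count a ≤ c a) ∨
    ∃ S : Set V, v ∈ S ∧ t ∉ S ∧
      ∀ T : Finset A, (∀ a, a ∈ T ↔ tl a ∈ S ∧ hd a ∉ S) → ∑ a ∈ T, c a ≤ 1 := by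
  rcases step tl hd v t c (fun _ => 0) 0 (fun _ => le_rfl) hc (by intro S; simp) with
    ⟨f, h0, h1, hf⟩ | ⟨S, hv, ht, h⟩
  swap
  · right; exact ⟨S, hv, ht, fun T hT => by rw [h T hT]; norm_num⟩
  rcases step tl hd v t c f _ h0 h1 hf with ⟨g, g0, g1, hg⟩ | ⟨S, hv, ht, h⟩
  swap
  · right; exact ⟨S, hv, ht, fun T hT => by rw [h T hT]; norm_num⟩
  left
  obtain ⟨Q₁, p1, c1, hg1⟩ := decomp tl hd v t g _ (by norm_num) g0 hg
  obtain ⟨Q₂, p2, c2, _⟩ := decomp tl hd v t _ _ (by norm_num) (fun a => sub_nonneg.2 (c1 a)) hg1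
  refine ⟨Q₁, Q₂, p1, p2, fun a => ?_⟩
  have := c2 a
  have := g1 a
  omega

/-- exchange -/
theorem exchange (tl hd : A → V) (s t : V) (D : A → Prop) (P Q p₁ p₂ q₁ q₂ : List A) (d e : A)
    (hP : IsPath tl hd s t P) (hQ : IsPath tl hd s t Q) (hPD : ∀ a ∈ P, D a) (hQD : ∀ a ∈ Q, D a)
    (eP : P = p₁ ++ d :: p₂) (eQ : Q = q₁ ++ d :: q₂)
    (hB : ∀ R, IsPath tl hd s t R → (∀ a ∈ R, D a) → e ∈ R) : e ∈ p₁ ∨ e = d ∨ e ∈ q₂ := by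
  subst eP eQ
  obtain ⟨u, h1, h2, h3⟩ := (walk_append tl hd _ _ _ _).1 hP.1
  obtain ⟨u', h4, h5, h6⟩ := (walk_append tl hd _ _ _ _).1 hQ.1
  obtain ⟨R, hR, hs⟩ := walk_to_path tl hd t (p₁ ++ d :: q₂) s
    ((walk_append tl hd _ _ _ _).2 ⟨u, h1, h2, h6⟩)
  have := hs (hB R hR (fun a ha => by
    have := hs ha
    simp only [List.mem_append, List.mem_cons] at this
    rcases this with h | h | h
    · exact hPD a (by simp [h])
    · exact hPD a (by simp [h])
    · exact hQD a (by simp [h])))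
  simpa using this

theorem exists_last (E : A → Prop) (L : List A) (h : ∃ a ∈ L, E a) :
    ∃ l₁ d l₂, L = l₁ ++ d :: l₂ ∧ E d ∧ ∀ a ∈ l₂, ¬ E a := by
  induction L with
  | nil => simp at h
  | cons a l ih =>
    by_cases h' : ∃ a ∈ l, E a
    · obtain ⟨l₁, d, l₂, e, h1, h2⟩ := ih h'
      exact ⟨a :: l₁, d, l₂, by simp [e], h1, h2⟩
    · push Not at h'
      refine ⟨[], a, l, rfl, ?_, h'⟩
      obtain ⟨b, hb, hE⟩ := h
      rw [List.mem_cons] at hb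
      rcases hb with rfl | hb
      · exact hE
      · exact absurd hE (h' b hb)

open Classical in
noncomputable def nodupLists (A : Type) [Fintype A] : Finset (List A) :=
  (Finset.univ : Finset {l : List A // l.Nodup}).image Subtype.val

open Classical in
theorem sumOver_eq [Fintype A] (x : List A → ℝ) (S : Set (List A))
    (hS : ∀ P ∈ S, P.Nodup) : sumOver x S = ∑ P ∈ nodupLists A, if P ∈ S then x P else 0 := by
  unfold sumOver
  rw [← Finset.sum_filter]
  apply finsum_mem_eq_sum_of_inter_support_eq
  ext P
  simp [nodupLists]
  intro _ h
  exact hS P h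

theorem mem_nodupLists [Fintype A] (P : List A) : P ∈ nodupLists A ↔ P.Nodup := by
  simp [nodupLists]

open Classical in
theorem arcFlow_eq [Fintype A] (tl hd : A → V) (s t : V) (x : List A → ℝ)
    (hx : ∀ P, ¬ IsPath tl hd s t P → x P = 0) (a : A) :
    arcFlow tl hd s t x a = ∑ P ∈ nodupLists A, if a ∈ P then x P else 0 := by
  unfold arcFlow
  rw [sumOver_eq _ _ (fun P hP => path_nodup _ _ _ _ _ hP.1)]
  refine Finset.sum_congr rfl fun P _ => ?_
  by_cases h : IsPath tl hd s t P
  · simp [h]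
  · simp [hx P h]

open Classical in
theorem flowVal_eq [Fintype A] (tl hd : A → V) (s t : V) (x : List A → ℝ)
    (hx : ∀ P, ¬ IsPath tl hd s t P → x P = 0) :
    flowVal tl hd s t x = ∑ P ∈ nodupLists A, x P := by
  unfold flowVal
  rw [sumOver_eq x {P | IsPath tl hd s t P} (fun P hP => path_nodup tl hd s t _ hP)]
  refine Finset.sum_congr rfl fun P _ => ?_
  by_cases h : IsPath tl hd s t P
  · simp [h]
  · simp [hx P h]

open Classical in
theorem availCap_eq [Fintype A] (tl hd : A → V) (s t : V) (x : List A → ℝ)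
    (hx : ∀ P, ¬ IsPath tl hd s t P → x P = 0) (b a : A)
    (hb : ∀ P, x P ≠ 0 → ¬ Before P b a) :
    availCap tl hd s t (fun _ => 1) x b a = 1 - arcFlow tl hd s t x a := by
  rw [arcFlow_eq _ _ _ _ _ hx]
  unfold availCap
  rw [sumOver_eq _ _ (fun P hP => path_nodup _ _ _ _ _ hP.1)]
  congr 1
  refine Finset.sum_congr rfl fun P _ => ?_
  by_cases h : x P = 0
  · simp [h]
  · have h1 : IsPath tl hd s t P := by
      by_contra h2
      exact h (hx P h2)
    simp [h1, hb P h]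

open Classical in
theorem rerouting_cut [Fintype A] [DecidableEq A] (tl hd : A → V) (s t : V) (u : A → ℝ) (x y : List A → ℝ) (b : A)
    (hy : IsRerouting tl hd s t u x b y) (S : Set V) (hb : tl b ∈ S) (ht : t ∉ S)
    (T : Finset A) (hT : ∀ a, a ∈ T ↔ tl a ∈ S ∧ hd a ∉ S) :
    arcFlow tl hd s t x b ≤ ∑ e ∈ T.erase b, availCap tl hd s t u x b e := by
  obtain ⟨y0, y1, y2, y3⟩ := hy
  rw [← y3]
  calc reVal tl hd t b y ≤ ∑ e ∈ T.erase b, reArcFlow tl hd t b y e := ?_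
    _ ≤ _ := Finset.sum_le_sum fun e he => y2 e (Finset.ne_of_mem_erase he)
  unfold reVal reArcFlow
  rw [sumOver_eq _ _ (fun P hP => path_nodup _ _ _ _ _ hP.1)]
  have : ∀ e, sumOver y {Q | IsPath tl hd (tl b) t Q ∧ b ∉ Q ∧ e ∈ Q} = _ :=
    fun e => sumOver_eq _ _ (fun P hP => path_nodup _ _ _ _ _ hP.1)
  simp only [this]
  rw [Finset.sum_comm]
  refine Finset.sum_le_sum fun Q _ => ?_
  have hnn : ∀ e ∈ T.erase b, 
      0 ≤ @ite ℝ (Q ∈ {Q | IsPath tl hd (tl b) t Q ∧ b ∉ Q ∧ e ∈ Q}) (propDecidable _) (y Q) 0 := by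
    intro e _
    split_ifs
    · exact y0 Q
    · exact le_rfl
  by_cases h : Q ∈ {Q | IsPath tl hd (tl b) t Q ∧ b ∉ Q}
  · obtain ⟨h1, h2⟩ := h
    obtain ⟨e, he, h3, h4⟩ := walk_cross tl hd S t ht Q _ h1.1 hb
    have hne : e ≠ b := fun h => h2 (h ▸ he)
    refine le_trans ?_ (Finset.single_le_sum hnn (Finset.mem_erase.2 ⟨hne, (hT e).2 ⟨h3, h4⟩⟩))
    simp [h1, h2, he]
  · rw [if_neg h]
    exact Finset.sum_nonneg hnn

theorem key_cut [Fintype A] [DecidableEq A] (tl hd : A → V) (s t : V) (x : List A → ℝ)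
    (hx : IsFlow tl hd s t (fun _ => (1 : ℝ)) x)
    (hr : Reroutable tl hd s t (fun _ => (1 : ℝ)) x) (hv : flowVal tl hd s t x = 1)
    (D : A → Prop) (hD : ∀ a, D a ↔ ∃ P, x P ≠ 0 ∧ a ∈ P)
    (B : A → Prop) (hB : ∀ e, B e ↔ ∀ R, IsPath tl hd s t R → (∀ a ∈ R, D a) → e ∈ R)
    (R : List A) (hR : IsPath tl hd s t R) (hRD : ∀ a ∈ R, D a)
    (S : Set V) (ht : t ∉ S)
    (T : Finset A) (hT : ∀ a, a ∈ T ↔ tl a ∈ S ∧ hd a ∉ S) (hne : T.Nonempty)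
    (hTR : ∀ e ∈ T, e ∈ R) (hTB : ∀ e ∈ T, ∀ e' ∈ T, e ≠ e' → B e ∨ B e') : False := by
  obtain ⟨x0, x1, x2⟩ := hx
  have hpath : ∀ P, x P ≠ 0 → IsPath tl hd s t P := fun P h => by
    by_contra h2
    exact h (x1 P h2)
  have hPD : ∀ P, x P ≠ 0 → ∀ a ∈ P, D a := fun P h a ha => (hD a).2 ⟨P, h, ha⟩
  have hfB : ∀ e, B e → arcFlow tl hd s t x e = 1 := by
    intro e he
    rw [← hv, flowVal_eq _ _ _ _ _ x1, arcFlow_eq _ _ _ _ _ x1]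
    refine Finset.sum_congr rfl fun P _ => ?_
    by_cases h : x P = 0
    · simp [h]
    · rw [if_pos ((hB e).1 he P (hpath P h) (hPD P h))]
  have hfD : ∀ e, D e → 0 < arcFlow tl hd s t x e := by
    intro e he
    obtain ⟨P, h1, h2⟩ := (hD e).1 he
    rw [arcFlow_eq _ _ _ _ _ x1]
    apply Finset.sum_pos'
    · intro P _
      split_ifs
      · exact x0 P
      · exact le_rfl
    · refine ⟨P, (mem_nodupLists P).2 (path_nodup _ _ _ _ _ (hpath P h1)), ?_⟩
      rw [if_pos h2]
      exact lt_of_le_of_ne (x0 P) (Ne.symm h1)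
  obtain ⟨e0, he0⟩ := hne
  obtain ⟨l₁, d, l₂, hl, hd1, hd2⟩ := exists_last (fun a => a ∈ T) R ⟨e0, hTR e0 he0, he0⟩
  have hRn := path_nodup _ _ _ _ _ hR
  obtain ⟨y, hy⟩ := hr d
  have hcut := rerouting_cut tl hd s t _ x y d hy S ((hT d).1 hd1).1 ht T hT
  have hav : ∀ e ∈ T.erase d, availCap tl hd s t (fun _ => 1) x d e = 1 - arcFlow tl hd s t x e := by
    intro e he
    obtain ⟨hed, heT⟩ := Finset.mem_erase.1 he
    refine availCap_eq _ _ _ _ _ x1 _ _ ?_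
    rintro P hP ⟨p₁, p₂, p₃, hp⟩
    have hPn := path_nodup _ _ _ _ _ (hpath P hP)
    have heR := hTR e heT
    have hel : e ∈ l₁ := by
      rw [hl, List.mem_append, List.mem_cons] at heR
      rcases heR with h | h | h
      · exact h
      · exact absurd h hed
      · exact absurd heT (hd2 e h)
    rcases hTB e heT d hd1 hed with hb | hb
    · rcases exchange tl hd s t D P R p₁ (p₂ ++ e :: p₃) l₁ l₂ d e (hpath P hP) hR (hPD P hP) hRD
        hp hl ((hB e).1 hb) with h | h | h
      · rw [hp, List.nodup_append] at hPn
        exact hPn.2.2 e h e (by simp) rfl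
      · exact hed h
      · exact hd2 e h heT
    · obtain ⟨m₁, m₂, hm⟩ := List.append_of_mem hel
      rcases exchange tl hd s t D R P m₁ (m₂ ++ d :: l₂) (p₁ ++ d :: p₂) p₃ e d hR (hpath P hP) hRD
        (hPD P hP) (by rw [hl, hm]; simp) (by rw [hp]; simp) ((hB d).1 hb) with h | h | h
      · rw [hl, hm, List.nodup_append] at hRn
        exact hRn.2.2 d (by simp [h]) d (by simp) rfl
      · exact hed h.symm
      · rw [hp, List.nodup_append, List.nodup_cons] at hPn
        exact hPn.2.1.1 (by simp [h])
  rw [Finset.sum_congr rfl hav] at hcut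
  have h1 : 1 ≤ ∑ e ∈ T, (1 - arcFlow tl hd s t x e) := by
    rw [← Finset.add_sum_erase T _ hd1]
    linarith
  by_cases hall : ∀ e ∈ T, B e
  · rw [Finset.sum_eq_zero (fun e he => by rw [hfB e (hall e he)]; ring)] at h1
    norm_num at h1
  · push Not at hall
    obtain ⟨c, hc, hcB⟩ := hall
    rw [Finset.sum_eq_single_of_mem c hc (fun e he hec => by
      rcases hTB e he c hc hec with h | h
      · rw [hfB e h]; ring
      · exact absurd h hcB)] at h1
    have := hfD c (hRD c (hTR c hc))
    linarith

open Classical in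
noncomputable def wflow (p q : ℝ) (P₁ P₂ : List A) (L : List A) : ℝ :=
  (if L = P₁ then p else 0) + (if L = P₂ then q else 0)

open Classical in
theorem sumOver_wflow [Fintype A] (p q : ℝ) (P₁ P₂ : List A) (h₁ : P₁.Nodup) (h₂ : P₂.Nodup)
    (S : Set (List A)) (hS : ∀ P ∈ S, P.Nodup) :
    sumOver (wflow p q P₁ P₂) S = (if P₁ ∈ S then p else 0) + (if P₂ ∈ S then q else 0) := by
  rw [sumOver_eq _ _ hS, ← Finset.sum_filter]
  unfold wflow
  rw [Finset.sum_add_distrib, Finset.sum_ite_eq', Finset.sum_ite_eq']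
  simp [mem_nodupLists, h₁, h₂]

theorem wflow_nonneg (p q : ℝ) (hp : 0 ≤ p) (hq : 0 ≤ q) (P₁ P₂ L : List A) :
    0 ≤ wflow p q P₁ P₂ L := by
  unfold wflow
  split_ifs <;> linarith

/-- strict rerouting from weights -/
theorem strict_of_weights [Fintype A] [DecidableEq A] (tl hd : A → V) (s t : V) (u : A → ℝ)
    (x : List A → ℝ) (b : A) (p q : ℝ) (hp : 0 ≤ p) (hq : 0 ≤ q) (Q₁ Q₂ : List A)
    (h₁ : IsPath tl hd (tl b) t Q₁) (h₂ : IsPath tl hd (tl b) t Q₂)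
    (hb₁ : b ∈ Q₁ → p = 0) (hb₂ : b ∈ Q₂ → q = 0)
    (hc : ∀ a, (if a ∈ Q₁ then p else 0) + (if a ∈ Q₂ then q else 0)
      ≤ u a - arcFlow tl hd s t x a)
    (hval : p + q = arcFlow tl hd s t x b) :
    IsStrictRerouting tl hd s t u x b (wflow p q Q₁ Q₂) := by
  have n₁ := path_nodup _ _ _ _ _ h₁
  have n₂ := path_nodup _ _ _ _ _ h₂
  refine ⟨wflow_nonneg p q hp hq Q₁ Q₂, ?_, ?_, ?_⟩
  · intro Q hQ
    unfold wflow
    have e1 : (Q = Q₁ → p = 0) := by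
      rintro rfl
      exact hb₁ (by by_contra h; exact hQ ⟨h₁, h⟩)
    have e2 : (Q = Q₂ → q = 0) := by
      rintro rfl
      exact hb₂ (by by_contra h; exact hQ ⟨h₂, h⟩)
    split_ifs <;> simp_all
  · intro a _
    refine le_trans ?_ (hc a)
    unfold reArcFlow
    rw [sumOver_wflow _ _ _ _ n₁ n₂ _ (fun P hP => path_nodup _ _ _ _ _ hP.1)]
    apply add_le_add
    · by_cases h : a ∈ Q₁ <;> simp [h]
      split_ifs <;> simp [hp]
    · by_cases h : a ∈ Q₂ <;> simp [h]
      split_ifs <;> simp [hq]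
  · rw [← hval]
    unfold reVal
    rw [sumOver_wflow _ _ _ _ n₁ n₂ _ (fun P hP => path_nodup _ _ _ _ _ hP.1)]
    congr 1
    · by_cases h : b ∈ Q₁
      · simp [hb₁ h]
      · simp [h, h₁]
    · by_cases h : b ∈ Q₂
      · simp [hb₂ h]
      · simp [h, h₂]

/-- In a unit-capacity network, if some reroutable s-t-flow has value 1,
then there is a half-integral strictly reroutable s-t-flow of value 1 supported on at
most two s-t-paths. -/
theorem unit_value_one_half_integral
    {V A : Type} [Fintype V] [DecidableEq V] [Fintype A] [DecidableEq A]
    (tl hd : A → V) (s t : V)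
    (h : ∃ x : List A → ℝ, IsFlow tl hd s t (fun _ => (1 : ℝ)) x ∧
      Reroutable tl hd s t (fun _ => (1 : ℝ)) x ∧ flowVal tl hd s t x = 1) :
    ∃ x : List A → ℝ,
      IsFlow tl hd s t (fun _ => (1 : ℝ)) x ∧
      StrictlyReroutable tl hd s t (fun _ => (1 : ℝ)) x ∧
      flowVal tl hd s t x = 1 ∧
      (∀ P : List A, ∃ n : ℤ, 2 * x P = (n : ℝ)) ∧
      ∃ P₁ P₂ : List A, ∀ Q : List A, x Q ≠ 0 → Q = P₁ ∨ Q = P₂ := by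
  classical
  obtain ⟨x, hx, hr, hv⟩ := h
  obtain ⟨D, hD⟩ : ∃ D : A → Prop, ∀ a, D a ↔ ∃ P, x P ≠ 0 ∧ a ∈ P := ⟨_, fun _ => Iff.rfl⟩
  obtain ⟨B, hB⟩ : ∃ B : A → Prop, ∀ e, B e ↔
    ∀ R, IsPath tl hd s t R → (∀ a ∈ R, D a) → e ∈ R := ⟨_, fun _ => Iff.rfl⟩
  have hpath : ∀ P, x P ≠ 0 → IsPath tl hd s t P := fun P h => by
    by_contra h2
    exact h (hx.2.1 P h2)
  obtain ⟨P₀, hP₀⟩ : ∃ P, x P ≠ 0 := by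
    by_contra hcon
    push Not at hcon
    rw [flowVal_eq _ _ _ _ _ hx.2.1, Finset.sum_eq_zero (fun P _ => hcon P)] at hv
    norm_num at hv
  let c : A → ℤ := fun a => if D a then (if B a then 2 else 1) else 0
  have hc0 : ∀ a, 0 ≤ c a := by
    intro a
    simp only [c]
    split_ifs <;> norm_num
  -- the two paths
  obtain ⟨P₁, P₂, hP₁, hP₂, hcap⟩ : ∃ Q₁ Q₂, IsPath tl hd s t Q₁ ∧ IsPath tl hd s t Q₂ ∧
      ∀ a, (Q₁.count a : ℤ) + Q₂.count a ≤ c a := by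
    rcases two_paths tl hd s t c hc0 with h | ⟨S, hs, ht, hS⟩
    · exact h
    · exfalso
      have hT : ∀ a, a ∈ (Finset.univ.filter fun a => tl a ∈ S ∧ hd a ∉ S) ↔
        tl a ∈ S ∧ hd a ∉ S := by simp
      have hsum := hS _ hT
      obtain ⟨e, he, he1⟩ := walk_cross tl hd S t ht P₀ s (hpath _ hP₀).1 hs
      have heD : D e := (hD e).2 ⟨P₀, hP₀, he⟩
      have heB : B e := by
        rw [hB]
        intro R hR hRD
        obtain ⟨e', he', he1'⟩ := walk_cross tl hd S t ht R s hR.1 hs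
        by_contra hne
        have hee : e ≠ e' := fun h => hne (h ▸ he')
        have h2 : ∑ a ∈ {e, e'}, c a ≤ 1 := by
          refine le_trans (Finset.sum_le_sum_of_subset_of_nonneg ?_ (fun a _ _ => hc0 a)) hsum
          intro a ha
          rw [Finset.mem_insert, Finset.mem_singleton] at ha
          rcases ha with rfl | rfl
          · exact (hT _).2 he1
          · exact (hT _).2 he1'
        rw [Finset.sum_pair hee] at h2
        have h3 : 1 ≤ c e := by simp only [c, heD, if_true]; split_ifs <;> norm_num
        have h4 : 1 ≤ c e' := by simp only [c, hRD e' he', if_true]; split_ifs <;> norm_num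
        omega
      have h3 : c e = 2 := by simp [c, heD, heB]
      have := Finset.single_le_sum (fun a _ => hc0 a) ((hT e).2 he1)
      omega
  have n₁ := path_nodup _ _ _ _ _ hP₁
  have n₂ := path_nodup _ _ _ _ _ hP₂
  have hD1 : ∀ a ∈ P₁, D a := by
    intro a ha
    by_contra hn
    have := hcap a
    have h1 := List.count_pos_iff.2 ha
    simp only [c, hn, if_false] at this
    omega
  have hD2 : ∀ a ∈ P₂, D a := by
    intro a ha
    by_contra hn
    have := hcap a
    have h1 := List.count_pos_iff.2 ha
    simp only [c, hn, if_false] at this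
    omega
  have hBB : ∀ a, a ∈ P₁ → a ∈ P₂ → B a := by
    intro a h1 h2
    by_contra hn
    have := hcap a
    have h1 := List.count_pos_iff.2 h1
    have h2 := List.count_pos_iff.2 h2
    simp only [c, hn, if_false] at this
    split_ifs at this <;> omega
  have hw0 : ∀ P, ¬ IsPath tl hd s t P → wflow (1/2) (1/2) P₁ P₂ P = 0 := by
    intro P hP
    unfold wflow
    rw [if_neg (fun h : P = P₁ => hP (h ▸ hP₁)), if_neg (fun h : P = P₂ => hP (h ▸ hP₂)), add_zero]
  have haf : ∀ a, arcFlow tl hd s t (wflow (1/2) (1/2) P₁ P₂) a =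
      (if a ∈ P₁ then 1/2 else 0) + (if a ∈ P₂ then 1/2 else 0) := by
    intro a
    unfold arcFlow
    rw [sumOver_wflow _ _ _ _ n₁ n₂ _ (fun P hP => path_nodup _ _ _ _ _ hP.1)]
    simp [hP₁, hP₂]
  refine ⟨wflow (1/2) (1/2) P₁ P₂, ⟨wflow_nonneg _ _ (by norm_num) (by norm_num) _ _, hw0, ?_⟩,
    ?_, ?_, ?_, P₁, P₂, ?_⟩
  · intro a
    rw [haf]
    split_ifs <;> norm_num
  · intro b
    by_cases hb : b ∈ P₁ ∨ b ∈ P₂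
    swap
    · push Not at hb
      refine ⟨fun _ => 0, fun _ => le_rfl, fun _ _ => rfl, ?_, ?_⟩
      · intro a _
        rw [haf]
        unfold reArcFlow sumOver
        simp only [finsum_zero]
        split_ifs <;> norm_num
      · rw [haf]
        unfold reVal sumOver
        simp [hb]
    have hcn : ∀ a, (0 : ℤ) ≤ 2 - P₁.count a - P₂.count a := by
      intro a
      have h1 := List.nodup_iff_count_le_one.1 n₁ a
      have h2 := List.nodup_iff_count_le_one.1 n₂ a
      omega
    rcases two_paths tl hd (tl b) t (fun a => 2 - P₁.count a - P₂.count a) hcn with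
      ⟨Q₁, Q₂, hQ₁, hQ₂, hQ⟩ | ⟨S, hs, ht, hS⟩
    · have m₁ := path_nodup _ _ _ _ _ hQ₁
      have m₂ := path_nodup _ _ _ _ _ hQ₂
      have hQ' : ∀ a, ((if a ∈ Q₁ then 1 else 0) + (if a ∈ Q₂ then 1 else 0) : ℤ) ≤
          2 - (if a ∈ P₁ then 1 else 0) - (if a ∈ P₂ then 1 else 0) := by
        intro a
        have := hQ a
        simp only [n₁.count, n₂.count, m₁.count, m₂.count] at this
        exact_mod_cast this
      have hcc : ∀ p q : ℝ, p ≤ 1/2 → q ≤ 1/2 → 0 ≤ p → 0 ≤ q →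
          ∀ a, (if a ∈ Q₁ then p else 0) + (if a ∈ Q₂ then q else 0) ≤
            (fun _ => (1:ℝ)) a - arcFlow tl hd s t (wflow (1/2) (1/2) P₁ P₂) a := by
        intro p q hp hq hp0 hq0 a
        rw [haf]
        have := hQ' a
        show _ ≤ (1 : ℝ) - _
        split_ifs at this ⊢ <;> first | linarith | (exfalso; omega)
      have hQb := hQ' b
      by_cases b1 : b ∈ Q₁
      · refine ⟨_, strict_of_weights tl hd s t _ _ b 0 (1/2) le_rfl (by norm_num) Q₁ Q₂ hQ₁ hQ₂
          (fun _ => rfl) ?_ (hcc _ _ (by norm_num) (by norm_num) (by norm_num) (by norm_num)) ?_⟩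
        · intro b2
          exfalso
          simp only [b1, b2, if_true] at hQb
          split_ifs at hQb <;> first | omega | tauto
        · rw [haf]
          split_ifs at hQb ⊢ <;> first | (norm_num; done) | (exfalso; omega) | tauto
      · by_cases b12 : b ∈ P₁ ∧ b ∈ P₂
        · refine ⟨_, strict_of_weights tl hd s t _ _ b (1/2) (1/2) (by norm_num) (by norm_num)
            Q₁ Q₂ hQ₁ hQ₂ (fun h => absurd h b1) ?_
            (hcc _ _ (by norm_num) (by norm_num) (by norm_num) (by norm_num)) ?_⟩
          · intro b2
            exfalso
            simp only [b1, b2, b12.1, b12.2, if_true] at hQb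
            norm_num at hQb
          · rw [haf]
            simp [b12.1, b12.2]
        · refine ⟨_, strict_of_weights tl hd s t _ _ b (1/2) 0 (by norm_num) le_rfl
            Q₁ Q₂ hQ₁ hQ₂ (fun h => absurd h b1) (fun _ => rfl)
            (hcc _ _ (by norm_num) (by norm_num) (by norm_num) (by norm_num)) ?_⟩
          rw [haf]
          split_ifs <;> first | (norm_num; done) | tauto
    · exfalso
      obtain ⟨T, hT⟩ : ∃ T : Finset A, ∀ a, a ∈ T ↔ tl a ∈ S ∧ hd a ∉ S :=
        ⟨Finset.univ.filter fun a => tl a ∈ S ∧ hd a ∉ S, by simp⟩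
      have hsum := hS T hT
      have hpair : ∀ e ∈ T, ∀ e' ∈ T, e ≠ e' →
          (e ∈ P₁ ∧ e ∈ P₂) ∨ (e' ∈ P₁ ∧ e' ∈ P₂) := by
        intro e he e' he' hne
        have h2 : ∑ a ∈ {e, e'}, (2 - (P₁.count a : ℤ) - P₂.count a) ≤ 1 := by
          refine le_trans (Finset.sum_le_sum_of_subset_of_nonneg ?_ (fun a _ _ => hcn a)) hsum
          intro a ha
          rw [Finset.mem_insert, Finset.mem_singleton] at ha
          rcases ha with rfl | rfl
          · exact he
          · exact he'
        rw [Finset.sum_pair hne] at h2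
        simp only [n₁.count, n₂.count] at h2
        push_cast at h2
        split_ifs at h2 <;> first | tauto | (exfalso; omega)
      have hone : ∀ e ∈ T, e ∈ P₁ ∨ e ∈ P₂ := by
        intro e he
        have h2 := le_trans (Finset.single_le_sum (fun a _ => hcn a) he) hsum
        simp only [n₁.count, n₂.count] at h2
        push_cast at h2
        split_ifs at h2 <;> first | tauto | (exfalso; omega)
      have hne : T.Nonempty := by
        have : ∀ P, IsPath tl hd s t P → b ∈ P → T.Nonempty := by
          intro P hP hbP
          obtain ⟨l₁, l₂, rfl⟩ := List.append_of_mem hbP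
          obtain ⟨u, _, h2, h3⟩ := (walk_append tl hd _ _ _ _).1 hP.1
          obtain ⟨e, _, he⟩ := walk_cross tl hd S t ht (b :: l₂) (tl b) ⟨rfl, h3⟩ hs
          exact ⟨e, (hT e).2 he⟩
        rcases hb with hb | hb
        · exact this _ hP₁ hb
        · exact this _ hP₂ hb
      have hTB : ∀ e ∈ T, ∀ e' ∈ T, e ≠ e' → B e ∨ B e' := by
        intro e he e' he' hne
        rcases hpair e he e' he' hne with h | h
        · exact Or.inl (hBB _ h.1 h.2)
        · exact Or.inr (hBB _ h.1 h.2)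
      by_cases hall : ∀ e ∈ T, e ∈ P₁
      · exact key_cut tl hd s t x hx hr hv D hD B hB P₁ hP₁ hD1 S ht T hT hne hall hTB
      · push Not at hall
        obtain ⟨e, he, he1⟩ := hall
        refine key_cut tl hd s t x hx hr hv D hD B hB P₂ hP₂ hD2 S ht T hT hne ?_ hTB
        intro e' he'
        by_cases hee : e = e'
        · subst hee
          exact (hone e he).resolve_left he1
        · rcases hpair e he e' he' hee with h | h
          · exact absurd h.1 he1
          · exact h.2
  · unfold flowVal
    rw [sumOver_wflow _ _ _ _ n₁ n₂ {P | IsPath tl hd s t P}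
      (fun P hP => path_nodup tl hd s t _ hP)]
    simp [hP₁, hP₂]
    norm_num
  · intro P
    unfold wflow
    split_ifs
    · exact ⟨2, by norm_num⟩
    · exact ⟨1, by norm_num⟩
    · exact ⟨1, by norm_num⟩
    · exact ⟨0, by norm_num⟩
  · intro Q hQ
    by_contra hcon
    push Not at hcon
    apply hQ
    unfold wflow
    rw [if_neg hcon.1, if_neg hcon.2, add_zero]
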